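/- arXiv:2211.06980 — 10 statements merged into one kernel-verified Lean document; each statement's English description precedes it below -/
import Mathlib

section
/- If S is a Pouna set, then the interior of its bounding box is not contained in S; that is, box(S)° ∖ S ≠ ∅. -/
open Set

noncomputable def lS (S : Set (ℝ × ℝ)) : ℝ := sInf (Prod.fst '' S)
noncomputable def rS (S : Set (ℝ × ℝ)) : ℝ := sSup (Prod.fst '' S)
noncomputable def bS (S : Set (ℝ × ℝ)) : ℝ := sInf (Prod.snd '' S)
noncomputable def tS (S : Set (ℝ × ℝ)) : ℝ := sSup (Prod.snd '' S)

/-- The bounding box of a bounded set in the plane. -/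
noncomputable def boxS (S : Set (ℝ × ℝ)) : Set (ℝ × ℝ) :=
  Icc (lS S) (rS S) ×ˢ Icc (bS S) (tS S)

/-- A Pouna set: nonempty, compact, path-connected, not an axis-parallel rectangle. -/
def Pouna (S : Set (ℝ × ℝ)) : Prop :=
  S.Nonempty ∧ IsCompact S ∧ IsPathConnected S ∧
    ¬ ∃ a b c d : ℝ, S = Icc a b ×ˢ Icc c d

/-- The territory of a set. -/
def Ter (S : Set (ℝ × ℝ)) : Set (ℝ × ℝ) :=
  {p | p ∈ boxS S \ S ∧ ∃ x' > p.1, (x', p.2) ∈ S}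

/-- A strong Pouna set: a Pouna set with nonempty territory. -/
def Strong (S : Set (ℝ × ℝ)) : Prop := Pouna S ∧ (Ter S).Nonempty

/-- `Prec A B` (`A ≺ B`): the bounding box of `A` is inside the territory of `B`. -/
def Prec (A B : Set (ℝ × ℝ)) : Prop := boxS A ⊆ Ter B

/-- `Adj A B` (`A ↷ B`). -/
def Adj (A B : Set (ℝ × ℝ)) : Prop :=
  A ≠ B ∧ (A ∩ B).Nonempty ∧
  lS B ≤ lS A ∧ lS A < rS B ∧ rS B < rS A ∧
  bS B < bS A ∧ bS A < tS A ∧ tS A < tS B ∧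
  {p : ℝ × ℝ | p ∈ A ∧ p.1 = lS A} ⊆ Ter B

theorem fst_image_eq_Icc {S : Set (ℝ × ℝ)} (hc : IsCompact S) (hp : IsConnected S) :
    Prod.fst '' S = Icc (lS S) (rS S) :=
  eq_Icc_of_connected_compact (hp.image _ continuous_fst.continuousOn) (hc.image continuous_fst)

theorem snd_image_eq_Icc {S : Set (ℝ × ℝ)} (hc : IsCompact S) (hp : IsConnected S) :
    Prod.snd '' S = Icc (bS S) (tS S) :=
  eq_Icc_of_connected_compact (hp.image _ continuous_snd.continuousOn) (hc.image continuous_snd)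

/-- A compact connected set containing the interior of its bounding box is that box. -/
theorem eq_boxS_of_interior_subset {S : Set (ℝ × ℝ)} (hc : IsCompact S) (hp : IsConnected S)
    (h : interior (boxS S) ⊆ S) : S = boxS S := by
  have hfst := fst_image_eq_Icc hc hp
  have hsnd := snd_image_eq_Icc hc hp
  have hsub : S ⊆ boxS S := fun p hpS =>
    ⟨hfst ▸ mem_image_of_mem Prod.fst hpS, hsnd ▸ mem_image_of_mem Prod.snd hpS⟩
  refine hsub.antisymm fun p hpbox => ?_
  rcases eq_or_ne (lS S) (rS S) with hlr | hlr
  · obtain ⟨q, hq, hqp⟩ : p.2 ∈ Prod.snd '' S := hsnd ▸ hpbox.2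
    have hq1 := (hsub hq).1
    have hp1 := hpbox.1
    rw [hlr, Icc_self, mem_singleton_iff] at hq1 hp1
    rwa [← Prod.ext (hq1.trans hp1.symm) hqp]
  rcases eq_or_ne (bS S) (tS S) with hbt | hbt
  · obtain ⟨q, hq, hqp⟩ : p.1 ∈ Prod.fst '' S := hfst ▸ hpbox.1
    have hq2 := (hsub hq).2
    have hp2 := hpbox.2
    rw [hbt, Icc_self, mem_singleton_iff] at hq2 hp2
    rwa [← Prod.ext hqp (hq2.trans hp2.symm)]
  have hcl := closure_minimal h hc.isClosed
  rw [boxS, interior_prod_eq, interior_Icc, interior_Icc, closure_prod_eq,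
    closure_Ioo hlr, closure_Ioo hbt] at hcl
  exact hcl hpbox

/-- If `S` is a Pouna set, then the interior of its bounding box is not contained in `S`. -/
theorem stmt_0 (S : Set (ℝ × ℝ)) (hS : Pouna S) :
    (interior (boxS S) \ S).Nonempty := by
  obtain ⟨-, hc, hp, hrect⟩ := hS
  rw [sdiff_nonempty]
  exact fun h => hrect ⟨_, _, _, _, eq_boxS_of_interior_subset hc hp.isConnected h⟩
end

section
/- For every Pouna set S, either S is strong or the horizontal reflection of S, namely {(−x, y) : (x,y) ∈ S}, is strong; that is, Ter(S) ≠ ∅ or Ter({(−x,y) : (x,y) ∈ S}) ≠ ∅. -/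
open Set

theorem mem_boxS_iff {S : Set (ℝ × ℝ)} (hne : S.Nonempty) (hS : IsCompact S) (p : ℝ × ℝ) :
    p ∈ boxS S ↔ ((∃ q ∈ S, q.1 ≤ p.1) ∧ (∃ q ∈ S, p.1 ≤ q.1)) ∧
      (∃ q ∈ S, q.2 ≤ p.2) ∧ (∃ q ∈ S, p.2 ≤ q.2) := by
  have h₁ : IsCompact (Prod.fst '' S) := hS.image continuous_fst
  have h₂ : IsCompact (Prod.snd '' S) := hS.image continuous_snd
  constructor
  · rintro ⟨⟨hl, hr⟩, hb, ht⟩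
    obtain ⟨ql, hql, el⟩ := h₁.sInf_mem (hne.image _)
    obtain ⟨qr, hqr, er⟩ := h₁.sSup_mem (hne.image _)
    obtain ⟨qb, hqb, eb⟩ := h₂.sInf_mem (hne.image _)
    obtain ⟨qt, hqt, et⟩ := h₂.sSup_mem (hne.image _)
    exact ⟨⟨⟨ql, hql, el.trans_le hl⟩, ⟨qr, hqr, hr.trans_eq er.symm⟩⟩,
      ⟨qb, hqb, eb.trans_le hb⟩, ⟨qt, hqt, ht.trans_eq et.symm⟩⟩
  · rintro ⟨⟨⟨ql, hql, el⟩, ⟨qr, hqr, er⟩⟩, ⟨qb, hqb, eb⟩, ⟨qt, hqt, et⟩⟩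
    exact ⟨⟨(csInf_le h₁.bddBelow (mem_image_of_mem _ hql)).trans el,
      er.trans (le_csSup h₁.bddAbove (mem_image_of_mem _ hqr))⟩,
      (csInf_le h₂.bddBelow (mem_image_of_mem _ hqb)).trans eb,
      et.trans (le_csSup h₂.bddAbove (mem_image_of_mem _ hqt))⟩

/-- For every Pouna set `S`, either `S` or its horizontal reflection is strong. -/
theorem stmt_1 (S : Set (ℝ × ℝ)) (hS : Pouna S) :
    (Ter S).Nonempty ∨ (Ter ((fun p : ℝ × ℝ => (-p.1, p.2)) '' S)).Nonempty := by
  obtain ⟨hne, hc, hp, hrect⟩ := hS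
  have hsub : S ⊆ boxS S := fun p h =>
    (mem_boxS_iff hne hc p).2 ⟨⟨⟨p, h, le_rfl⟩, ⟨p, h, le_rfl⟩⟩, ⟨p, h, le_rfl⟩, ⟨p, h, le_rfl⟩⟩
  obtain ⟨p, hpb, hpS⟩ : ∃ p ∈ boxS S, p ∉ S := by
    by_contra! h
    exact hrect ⟨_, _, _, _, hsub.antisymm h⟩
  obtain ⟨⟨⟨ql, hql, el⟩, ⟨qr, hqr, er⟩⟩, ⟨qb, hqb, eb⟩, ⟨qt, hqt, et⟩⟩ :=
    (mem_boxS_iff hne hc p).1 hpb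
  obtain ⟨q, hq, hqp⟩ : p.2 ∈ Prod.snd '' S :=
    hp.isConnected.isPreconnected.intermediate_value hqb hqt continuous_snd.continuousOn ⟨eb, et⟩
  rcases lt_trichotomy p.1 q.1 with h | h | h
  · exact Or.inl ⟨p, ⟨hpb, hpS⟩, q.1, h, hqp ▸ hq⟩
  · exact absurd (Prod.ext h hqp.symm ▸ hq) hpS
  · refine Or.inr ⟨(-p.1, p.2), ⟨?_, ?_⟩, -q.1, neg_lt_neg h, q, hq, by simp [hqp]⟩
    · rw [mem_boxS_iff (hne.image _) (hc.image (by fun_prop))]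
      exact ⟨⟨⟨_, mem_image_of_mem _ hqr, neg_le_neg er⟩, ⟨_, mem_image_of_mem _ hql, neg_le_neg el⟩⟩,
        ⟨_, mem_image_of_mem _ hqb, eb⟩, ⟨_, mem_image_of_mem _ hqt, et⟩⟩
    · rintro ⟨r, hr, e⟩
      simp only [Prod.mk.injEq, neg_inj] at e
      exact hpS (Prod.ext e.1 e.2 ▸ hr)
end

section
/- Let A and B be strong Pouna sets with A ≺ B. Then r(A) < r(B) and h(A) ≤ h(B). -/
open Set

/-- If `A ≺ B` for strong Pouna sets, then `r(A) < r(B)` and `h(A) ≤ h(B)`. -/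
theorem stmt_2 (A B : Set (ℝ × ℝ)) (hA : Strong A) (hB : Strong B) (h : Prec A B) :
    rS A < rS B ∧ tS A - bS A ≤ tS B - bS B := by
  obtain ⟨⟨-, hAc, -, -⟩, -⟩ := hA
  obtain ⟨⟨-, hBc, -, -⟩, -⟩ := hB
  have hA₁ : lS A ≤ rS A :=
    Real.sInf_le_sSup _ (hAc.image continuous_fst).bddBelow (hAc.image continuous_fst).bddAbove
  have hA₂ : bS A ≤ tS A :=
    Real.sInf_le_sSup _ (hAc.image continuous_snd).bddBelow (hAc.image continuous_snd).bddAbove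
  have hbot : (rS A, bS A) ∈ Ter B := h ⟨⟨hA₁, le_rfl⟩, ⟨le_rfl, hA₂⟩⟩
  have htop : (rS A, tS A) ∈ Ter B := h ⟨⟨hA₁, le_rfl⟩, ⟨hA₂, le_rfl⟩⟩
  obtain ⟨⟨⟨-, hb, -⟩, -⟩, x', hx', hxB⟩ := hbot
  obtain ⟨⟨⟨-, -, ht⟩, -⟩, -⟩ := htop
  have hx : x' ≤ rS B := le_csSup (hBc.image continuous_fst).bddAbove ⟨_, hxB, rfl⟩
  exact ⟨lt_of_lt_of_le hx' hx, sub_le_sub ht hb⟩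
end

section
/- The relation ≺ on strong Pouna sets is a strict partial order: it is transitive (if A ≺ B and B ≺ C then A ≺ C) and asymmetric (if A ≺ B then not B ≺ A); in particular it is irreflexive. -/
open Set

theorem subset_boxS_of_isCompact {S : Set (ℝ × ℝ)} (hS : IsCompact S) : S ⊆ boxS S := by
  have h₁ := hS.image continuous_fst
  have h₂ := hS.image continuous_snd
  intro p hp
  have hp₁ := mem_image_of_mem Prod.fst hp
  have hp₂ := mem_image_of_mem Prod.snd hp
  exact ⟨⟨csInf_le h₁.bddBelow hp₁, le_csSup h₁.bddAbove hp₁⟩,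
    ⟨csInf_le h₂.bddBelow hp₂, le_csSup h₂.bddAbove hp₂⟩⟩

theorem Ter_subset_boxS (S : Set (ℝ × ℝ)) : Ter S ⊆ boxS S := fun _ hp => hp.1.1

theorem Prec.trans {A B C : Set (ℝ × ℝ)} (hAB : Prec A B) (hBC : Prec B C) : Prec A C :=
  Subset.trans hAB ((Ter_subset_boxS B).trans hBC)

theorem Pouna.not_prec_self {A : Set (ℝ × ℝ)} (hA : Pouna A) : ¬ Prec A A := by
  intro h
  obtain ⟨p, hp⟩ := hA.1
  exact (h (subset_boxS_of_isCompact hA.2.1 hp)).1.2 hp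

/-- `≺` is a strict partial order on strong Pouna sets: transitive, asymmetric,
and in particular irreflexive. -/
theorem stmt_3 :
    (∀ A B C : Set (ℝ × ℝ), Strong A → Strong B → Strong C →
      Prec A B → Prec B C → Prec A C) ∧
    (∀ A B : Set (ℝ × ℝ), Strong A → Strong B → Prec A B → ¬ Prec B A) ∧
    (∀ A : Set (ℝ × ℝ), Strong A → ¬ Prec A A) :=
  ⟨fun _ _ _ _ _ _ hAB hBC => hAB.trans hBC,
    fun _ _ hA _ hAB hBA => hA.1.not_prec_self (hAB.trans hBA),
    fun _ hA => hA.1.not_prec_self⟩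
end

section
/- Let F be a finite family of strong Pouna sets satisfying constraints (C1), (C2) and (C5). If A, B, C ∈ F, A ↷ B and A ↷ C with B ≠ C, then B ≺ C or C ≺ B. -/
open Set

def ConstraintC1 (F : Set (Set (ℝ × ℝ))) : Prop :=
  ∀ A ∈ F, ∀ B ∈ F, A ≠ B → (A ∩ B).Nonempty → Adj A B ∨ Adj B A

def ConstraintC2 (F : Set (Set (ℝ × ℝ))) : Prop :=
  ∀ A ∈ F, ∀ B ∈ F, A ∩ B = ∅ → (A ∩ Ter B).Nonempty → Prec A B

def ConstraintC3 (F : Set (Set (ℝ × ℝ))) : Prop :=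
  ∀ A ∈ F, ∀ B ∈ F, A ≠ B → (A ∩ B).Nonempty → ¬ ∃ C ∈ F, C ⊆ Ter A ∩ Ter B

def ConstraintC4 (F : Set (Set (ℝ × ℝ))) : Prop :=
  ¬ ∃ A ∈ F, ∃ B ∈ F, ∃ C ∈ F, Prec A B ∧ Adj A C ∧ Adj B C

def ConstraintC5 (F : Set (Set (ℝ × ℝ))) : Prop :=
  ¬ ∃ A ∈ F, ∃ B ∈ F, ∃ C ∈ F, A ≠ B ∧ A ≠ C ∧ B ≠ C ∧
    (A ∩ B).Nonempty ∧ (A ∩ C).Nonempty ∧ (B ∩ C).Nonempty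

theorem exists_mem_fst_eq_lS {S : Set (ℝ × ℝ)} (hS : S.Nonempty) (hc : IsCompact S) :
    ∃ p ∈ S, p.1 = lS S :=
  (hc.image continuous_fst).sInf_mem (hS.image _)

theorem fst_le_rS {S : Set (ℝ × ℝ)} (hc : IsCompact S) {p : ℝ × ℝ} (hp : p ∈ S) :
    p.1 ≤ rS S :=
  le_csSup (hc.image continuous_fst).bddAbove (mem_image_of_mem _ hp)

/-- A point outside `S`, lying to the right of a point of `Ter S` and to the left of a point of `S`
on the same horizontal line, is in the territory of `S`. -/
theorem mem_Ter_of_lt {S : Set (ℝ × ℝ)} (hc : IsCompact S) {x y u v : ℝ}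
    (h : (x, y) ∈ Ter S) (hxu : x < u) (huv : u < v) (hv : (v, y) ∈ S) (hu : (u, y) ∉ S) :
    (u, y) ∈ Ter S :=
  ⟨⟨⟨⟨h.1.1.1.1.trans hxu.le, huv.le.trans (fst_le_rS hc hv)⟩, h.1.1.2⟩, hu⟩, v, huv, hv⟩

/-- Axiom (A2) for a finite family of strong Pouna sets satisfying (C1), (C2), (C5). -/
theorem stmt_7 (F : Set (Set (ℝ × ℝ))) (hfin : F.Finite)
    (hstrong : ∀ S ∈ F, Strong S)
    (h1 : ConstraintC1 F) (h2 : ConstraintC2 F) (h5 : ConstraintC5 F)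
    (A B C : Set (ℝ × ℝ)) (hA : A ∈ F) (hB : B ∈ F) (hC : C ∈ F)
    (hAB : Adj A B) (hAC : Adj A C) (hBC : B ≠ C) :
    Prec B C ∨ Prec C B := by
  have hdisj : B ∩ C = ∅ := by
    by_contra h
    exact h5 ⟨A, hA, B, hB, C, hC, hAB.1, hAC.1, hBC, hAB.2.1, hAC.2.1,
      nonempty_iff_ne_empty.2 h⟩
  obtain ⟨⟨x, y⟩, hpA, hpl⟩ :=
    exists_mem_fst_eq_lS (hstrong A hA).1.1 (hstrong A hA).1.2.1
  have hpB : (x, y) ∈ Ter B := hAB.2.2.2.2.2.2.2.2 ⟨hpA, hpl⟩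
  have hpC : (x, y) ∈ Ter C := hAC.2.2.2.2.2.2.2.2 ⟨hpA, hpl⟩
  obtain ⟨u, hu, huB⟩ := hpB.2
  obtain ⟨v, hv, hvC⟩ := hpC.2
  have huC : (u, y) ∉ C := fun h => (hdisj.subset ⟨huB, h⟩).elim
  have hvB : (v, y) ∉ B := fun h => (hdisj.subset ⟨h, hvC⟩).elim
  rcases lt_trichotomy u v with huv | rfl | hvu
  · exact .inl (h2 B hB C hC hdisj
      ⟨_, huB, mem_Ter_of_lt (hstrong C hC).1.2.1 hpC hu huv hvC huC⟩)
  · exact absurd hvC huC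
  · exact .inr (h2 C hC B hB (inter_comm B C ▸ hdisj)
      ⟨_, hvC, mem_Ter_of_lt (hstrong B hB).1.2.1 hpB hv hvu huB hvB⟩)
end

section
/- Let y₀ ≤ y₁ be real numbers and let γ : [0,1] → ℝ² be a continuous map such that the second coordinate of γ(0) equals y₀ and the second coordinate of γ(1) equals y₁. Then there exist x₀, x₁ ∈ [0,1] with x₀ ≤ x₁ such that the second coordinate of γ(x₀) equals y₀, the second coordinate of γ(x₁) equals y₁, and for every t ∈ [x₀, x₁] the second coordinate of γ(t) lies in [y₀, y₁]. -/
open Set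

/-- A continuous function attains each of its values on a compact interval for a first time. -/
theorem exists_isLeast_preimage_Icc {f : ℝ → ℝ} {a b c v : ℝ} (hf : ContinuousOn f (Icc a b))
    (hc : c ∈ Icc a b) (hv : f c = v) : ∃ x, IsLeast (Icc a b ∩ f ⁻¹' {v}) x :=
  (isCompact_Icc.of_isClosed_subset (hf.preimage_isClosed_of_isClosed isClosed_Icc
    isClosed_singleton) inter_subset_left).exists_isLeast ⟨c, hc, hv⟩

/-- A continuous function attains each of its values on a compact interval for a last time. -/
theorem exists_isGreatest_preimage_Icc {f : ℝ → ℝ} {a b c v : ℝ} (hf : ContinuousOn f (Icc a b))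
    (hc : c ∈ Icc a b) (hv : f c = v) : ∃ x, IsGreatest (Icc a b ∩ f ⁻¹' {v}) x :=
  (isCompact_Icc.of_isClosed_subset (hf.preimage_isClosed_of_isClosed isClosed_Icc
    isClosed_singleton) inter_subset_left).exists_isGreatest ⟨c, hc, hv⟩

/-- A path whose endpoints have second coordinates `y₀` and `y₁` contains a subpath
between the lines `y = y₀` and `y = y₁`, staying between them. -/
theorem stmt_10 (y₀ y₁ : ℝ) (hy : y₀ ≤ y₁) (γ : ℝ → ℝ × ℝ)
    (hγ : ContinuousOn γ (Icc 0 1))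
    (h0 : (γ 0).2 = y₀) (h1 : (γ 1).2 = y₁) :
    ∃ x₀ ∈ Icc (0:ℝ) 1, ∃ x₁ ∈ Icc (0:ℝ) 1, x₀ ≤ x₁ ∧
      (γ x₀).2 = y₀ ∧ (γ x₁).2 = y₁ ∧
      ∀ t ∈ Icc x₀ x₁, (γ t).2 ∈ Icc y₀ y₁ := by
  have hf : ContinuousOn (fun t => (γ t).2) (Icc 0 1) := continuous_snd.comp_continuousOn hγ
  obtain ⟨x₁, ⟨hx₁, hfx₁ : (γ x₁).2 = y₁⟩, hfirst⟩ :=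
    exists_isLeast_preimage_Icc hf (right_mem_Icc.2 zero_le_one) h1
  obtain ⟨x₀, ⟨hx₀, hfx₀ : (γ x₀).2 = y₀⟩, hlast⟩ :=
    exists_isGreatest_preimage_Icc (hf.mono (Icc_subset_Icc_right hx₁.2))
      (left_mem_Icc.2 hx₁.1) h0
  refine ⟨x₀, ⟨hx₀.1, hx₀.2.trans hx₁.2⟩, x₁, hx₁, hx₀.2, hfx₀, hfx₁, fun t ht => ⟨?_, ?_⟩⟩
  · by_contra! hlt
    obtain ⟨s, hs, hfs⟩ := intermediate_value_Icc ht.2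
      (hf.mono (Icc_subset_Icc (hx₀.1.trans ht.1) hx₁.2)) ⟨hlt.le, hy.trans_eq hfx₁.symm⟩
    have hsx : s ≤ x₀ := hlast ⟨⟨hx₀.1.trans (ht.1.trans hs.1), hs.2⟩, hfs⟩
    obtain rfl : s = t := le_antisymm (hsx.trans ht.1) hs.1
    exact hlt.ne hfs
  · by_contra! hlt
    obtain ⟨s, hs, hfs⟩ := intermediate_value_Icc ht.1
      (hf.mono (Icc_subset_Icc hx₀.1 (ht.2.trans hx₁.2))) ⟨hfx₀.trans_le hy, hlt.le⟩
    have hsx : x₁ ≤ s := hfirst ⟨⟨hx₀.1.trans hs.1, hs.2.trans (ht.2.trans hx₁.2)⟩, hfs⟩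
    obtain rfl : s = t := le_antisymm hs.2 (ht.2.trans hsx)
    exact hlt.ne' hfs
end

section
/- Let R = [x₁, x₂] × [y₁, y₂] be an axis-parallel rectangle in ℝ² (x₁ ≤ x₂, y₁ ≤ y₂). Let α : [0,1] → R be a continuous map with the second coordinate of α(0) equal to y₁ and the second coordinate of α(1) equal to y₂, and let β : [0,1] → R be a continuous map with the first coordinate of β(0) equal to x₁ and the first coordinate of β(1) equal to x₂. Then the images of α and β intersect: im(α) ∩ im(β) ≠ ∅. -/
open Set

/-- A continuous nowhere vanishing function on the plane has a continuous logarithm, whose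
value at a given point may be prescribed. -/
theorem exists_continuous_log_plane {F : ℝ × ℝ → ℂ} (hF : Continuous F) (h0 : ∀ p, F p ≠ 0)
    {p₀ : ℝ × ℝ} {w : ℂ} (hw : Complex.exp w = F p₀) :
    ∃ L : ℝ × ℝ → ℂ, Continuous L ∧ L p₀ = w ∧ ∀ p, Complex.exp (L p) = F p := by
  obtain ⟨L, ⟨hL₀, hL⟩, -⟩ :=
    Complex.isCoveringMapOn_exp.existsUnique_continuousMap_lifts ⟨F, hF⟩ hw h0
  exact ⟨L, L.continuous, hL₀, congrFun hL⟩

/-- A continuous function with nonnegative sine cannot exceed `π` if it takes a value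
at most `π`. -/
theorem le_pi_of_sin_nonneg {f : ℝ → ℝ} (hf : Continuous f) (hs : ∀ t, 0 ≤ Real.sin (f t))
    {a : ℝ} (ha : f a ≤ Real.pi) (b : ℝ) : f b ≤ Real.pi := by
  by_contra! hb
  have hpi := Real.pi_pos
  obtain ⟨t, ht⟩ := mem_range_of_exists_le_of_exists_ge hf
    (c := min (f b) (3 * Real.pi / 2)) ⟨a, le_min (by linarith) (by linarith)⟩
    ⟨b, min_le_left _ _⟩
  have h1 : Real.pi < f t := ht ▸ lt_min hb (by linarith)
  have h2 : f t ≤ 3 * Real.pi / 2 := ht ▸ min_le_right _ _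
  have h3 := Real.sin_pos_of_pos_of_lt_pi (x := f t - Real.pi) (by linarith) (by linarith)
  rw [Real.sin_sub_pi] at h3
  linarith [hs t]

/-- A continuous function with nonnegative sine which takes a value in `[0, π]` has all its
values in `[0, π]`. -/
theorem mem_Icc_pi_of_sin_nonneg {f : ℝ → ℝ} (hf : Continuous f)
    (hs : ∀ t, 0 ≤ Real.sin (f t)) {a : ℝ} (ha : f a ∈ Icc 0 Real.pi) (b : ℝ) :
    f b ∈ Icc 0 Real.pi := by
  refine ⟨?_, le_pi_of_sin_nonneg hf hs ha.2 b⟩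
  have := le_pi_of_sin_nonneg (f := fun t ↦ Real.pi - f t) (by fun_prop)
    (fun t ↦ by simpa [Real.sin_pi_sub] using hs t) (a := a) (by linarith [ha.1]) b
  linarith

/-- A continuous function on the plane which satisfies sign conditions modelled on the
four sides of a square, on the lines carrying these sides, has a zero. -/
theorem exists_zero_of_side_signs {F : ℝ × ℝ → ℂ} (hF : Continuous F)
    (hbot : ∀ t, (F (0, t)).im ≤ 0) (htop : ∀ t, 0 ≤ (F (1, t)).im)
    (hleft : ∀ s, 0 ≤ (F (s, 0)).re) (hright : ∀ s, (F (s, 1)).re ≤ 0) :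
    ∃ p, F p = 0 := by
  by_contra! h0
  have hpi := Real.pi_pos
  obtain ⟨L, hLc, hL₀, hL⟩ := exists_continuous_log_plane hF h0 (Complex.exp_log (h0 (0, 0)))
  obtain ⟨θ, hθ⟩ : ∃ θ : ℝ × ℝ → ℝ, θ = fun p ↦ (L p).im := ⟨_, rfl⟩
  have hc : Continuous θ := by rw [hθ]; fun_prop
  have hre (p) : (F p).re = Real.exp (L p).re * Real.cos (θ p) := by
    rw [← hL p, Complex.exp_re, hθ]
  have him (p) : (F p).im = Real.exp (L p).re * Real.sin (θ p) := by
    rw [← hL p, Complex.exp_im, hθ]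
  have cbot (t) : Real.sin (θ (0, t)) ≤ 0 :=
    nonpos_of_mul_nonpos_right (him (0, t) ▸ hbot t) (Real.exp_pos _)
  have ctop (t) : 0 ≤ Real.sin (θ (1, t)) :=
    nonneg_of_mul_nonneg_right (him (1, t) ▸ htop t) (Real.exp_pos _)
  have cleft (s) : 0 ≤ Real.cos (θ (s, 0)) :=
    nonneg_of_mul_nonneg_right (hre (s, 0) ▸ hleft s) (Real.exp_pos _)
  have cright (s) : Real.cos (θ (s, 1)) ≤ 0 :=
    nonpos_of_mul_nonpos_right (hre (s, 1) ▸ hright s) (Real.exp_pos _)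
  have h00 : |θ (0, 0)| ≤ Real.pi / 2 := by
    simpa only [hθ, hL₀, Complex.log_im, Complex.abs_arg_le_pi_div_two_iff] using hleft 0
  obtain ⟨h1, h2⟩ := abs_le.1 h00
  have h3 : θ (0, 0) ≤ 0 := by
    by_contra! h
    linarith [cbot 0, Real.sin_pos_of_pos_of_lt_pi h (by linarith)]
  obtain ⟨h01, h01'⟩ := mem_Icc_pi_of_sin_nonneg (f := fun t ↦ θ (0, t) + Real.pi)
    (by fun_prop) (fun t ↦ by simpa [Real.sin_add_pi] using cbot t) (a := 0)
    ⟨by linarith, by linarith⟩ 1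
  have h4 : θ (0, 1) ≤ -(Real.pi / 2) := by
    by_contra! h
    linarith [cright 0, Real.cos_pos_of_mem_Ioo ⟨h, by linarith⟩]
  obtain ⟨-, h11⟩ := mem_Icc_pi_of_sin_nonneg
    (f := fun s ↦ θ (s, 1) + Real.pi + Real.pi / 2) (by fun_prop)
    (fun s ↦ by simpa [Real.sin_add_pi_div_two, Real.cos_add_pi] using cright s) (a := 0)
    ⟨by linarith, by linarith⟩ 1
  obtain ⟨h10, h10'⟩ := mem_Icc_pi_of_sin_nonneg
    (f := fun s ↦ θ (s, 0) + Real.pi / 2) (by fun_prop)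
    (fun s ↦ by simpa [Real.sin_add_pi_div_two] using cleft s) (a := 0)
    ⟨by linarith, by linarith⟩ 1
  have h5 : 0 ≤ θ (1, 0) := by
    by_contra! h
    linarith [ctop 0, Real.sin_neg_of_neg_of_neg_pi_lt h (by linarith)]
  obtain ⟨h6, -⟩ := mem_Icc_pi_of_sin_nonneg (f := fun t ↦ θ (1, t)) (by fun_prop) ctop
    (a := 0) ⟨h5, by linarith⟩ 1
  linarith

/-- In a rectangle, a path joining the bottom side to the top side meets every path
joining the left side to the right side. -/
theorem stmt_12 (x₁ x₂ y₁ y₂ : ℝ) (hx : x₁ ≤ x₂) (hy : y₁ ≤ y₂)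
    (α β : ℝ → ℝ × ℝ)
    (hα : ContinuousOn α (Icc 0 1)) (hβ : ContinuousOn β (Icc 0 1))
    (hαmem : MapsTo α (Icc (0:ℝ) 1) (Icc x₁ x₂ ×ˢ Icc y₁ y₂))
    (hβmem : MapsTo β (Icc (0:ℝ) 1) (Icc x₁ x₂ ×ˢ Icc y₁ y₂))
    (hα0 : (α 0).2 = y₁) (hα1 : (α 1).2 = y₂)
    (hβ0 : (β 0).1 = x₁) (hβ1 : (β 1).1 = x₂) :
    (α '' Icc 0 1 ∩ β '' Icc 0 1).Nonempty := by
  have key : Continuous fun p : ℝ × ℝ ↦ Complex.equivRealProdCLM.symm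
      (IccExtend zero_le_one (domRestrict (Icc 0 1) α) p.1
        - IccExtend zero_le_one (domRestrict (Icc 0 1) β) p.2) := by
    have h1 := hα.domRestrict.Icc_extend' (h := zero_le_one)
    have h2 := hβ.domRestrict.Icc_extend' (h := zero_le_one)
    fun_prop
  have hm (t : ℝ) := hαmem (projIcc 0 1 zero_le_one t).2
  have hn (t : ℝ) := hβmem (projIcc 0 1 zero_le_one t).2
  simp only [mem_prod, mem_Icc] at hm hn
  obtain ⟨p, hp⟩ := exists_zero_of_side_signs key
    (fun t ↦ by simpa [IccExtend, domRestrict_def, hα0] using (hn t).2.1)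
    (fun t ↦ by simpa [IccExtend, domRestrict_def, hα1] using (hn t).2.2)
    (fun s ↦ by simpa [IccExtend, domRestrict_def, hβ0] using (hm s).1.1)
    (fun s ↦ by simpa [IccExtend, domRestrict_def, hβ1] using (hm s).1.2)
  rw [map_eq_zero_iff _ Complex.equivRealProdCLM.symm.injective, sub_eq_zero] at hp
  exact ⟨_, ⟨_, (projIcc 0 1 zero_le_one p.1).2, hp⟩, ⟨_, (projIcc 0 1 zero_le_one p.2).2, rfl⟩⟩
end

section
/- Let p₁, …, p₅ be five distinct points in ℝ², and suppose that for every pair i < j there is a continuous map γ_{i,j} : [0,1] → ℝ² with γ_{i,j}(0) = pᵢ and γ_{i,j}(1) = pⱼ. Then there exist four distinct indices i, j, k, l such that the images of γ_{i,j} and γ_{k,l} intersect. -/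
open Set

/-- A nowhere vanishing continuous function on the plane has a continuous logarithm. -/
theorem exists_continuous_log {f : ℝ × ℝ → ℂ} (hf : Continuous f) (h0 : ∀ x, f x ≠ 0) :
    ∃ L : ℝ × ℝ → ℂ, Continuous L ∧ ∀ x, Complex.exp (L x) = f x := by
  obtain ⟨F, ⟨-, hF⟩, -⟩ := Complex.isCoveringMapOn_exp.existsUnique_continuousMap_lifts
    ⟨f, hf⟩ (a₀ := 0) (Complex.exp_log (h0 0)) h0
  exact ⟨F, F.continuous, congrFun hF⟩

/-- Two continuous logarithms of the same function on the line have the same increments. -/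
theorem sub_eq_sub_of_exp_eq_exp {F G : ℝ → ℂ} (hF : Continuous F) (hG : Continuous G)
    (h : ∀ t, Complex.exp (F t) = Complex.exp (G t)) (s t : ℝ) : F t - F s = G t - G s := by
  have key : F = fun u => G u + (F s - G s) := by
    refine Complex.isCoveringMap_exp.eq_of_comp_eq hF (by fun_prop) (funext fun u => ?_) s (by ring)
    have hs : Complex.exp (F s - G s) = 1 := Complex.exp_eq_exp_iff_exp_sub_eq_one.1 (h s)
    exact Subtype.ext (by simp [Complex.exp_add, hs, h])
  have := congrFun key t
  linear_combination this

/-- The increment from `0` to `1` of a continuous logarithm of `g - w` depends only on `g` and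
`w`, and is determined up to a multiple of `2 * π * I` by given logarithms `a` of `g 0 - w` and
`b` of `g 1 - w`. -/
theorem exists_winding_int (g : ℝ → ℂ) (w a b : ℂ) (ha : Complex.exp a = g 0 - w)
    (hb : Complex.exp b = g 1 - w) :
    ∃ n : ℤ, ∀ G : ℝ → ℂ, Continuous G → (∀ t, Complex.exp (G t) = g t - w) →
      G 1 - G 0 = b - a + n * (2 * Real.pi * Complex.I) := by
  by_cases hex : ∃ G : ℝ → ℂ, Continuous G ∧ ∀ t, Complex.exp (G t) = g t - w
  · obtain ⟨G, hG, hGe⟩ := hex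
    have hexp : Complex.exp (G 1 - G 0) = Complex.exp (b - a) := by
      rw [Complex.exp_sub, Complex.exp_sub, hGe, hGe, ha, hb]
    obtain ⟨n, hn⟩ := Complex.exp_eq_exp_iff_exists_int.1 hexp
    refine ⟨n, fun F hF hFe => ?_⟩
    rw [← hn]
    exact sub_eq_sub_of_exp_eq_exp hF hG (fun t => by rw [hFe, hGe]) 0 1
  · exact ⟨0, fun G hG hGe => absurd ⟨G, hG, hGe⟩ hex⟩

/-- A choice of logarithms of all differences of distinct values of `z` such that swapping two
points changes the logarithm by `π * I`. -/
theorem exists_log_differences {ι : Type*} [LinearOrder ι] (z : ι → ℂ)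
    (hz : Function.Injective z) :
    ∃ a : ι → ι → ℂ, (∀ i j, i ≠ j → Complex.exp (a i j) = z i - z j) ∧
      ∀ i j, i < j → a j i = a i j + Real.pi * Complex.I := by
  refine ⟨fun i j => if i < j then Complex.log (z i - z j)
    else Complex.log (z j - z i) + Real.pi * Complex.I, fun i j hij => ?_, fun i j hij => ?_⟩
  · have hne := sub_ne_zero.2 (hz.ne hij)
    have hne' := sub_ne_zero.2 (hz.ne hij.symm)
    dsimp only
    split_ifs
    · exact Complex.exp_log hne
    · rw [Complex.exp_add, Complex.exp_log hne', Complex.exp_pi_mul_I]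
      ring
  · simp [hij, hij.not_gt]

/-- For disjoint paths `g` and `h`, the increments around the unit square of a continuous logarithm
of `g s - h t` cancel. -/
theorem exists_log_increments {g h : ℝ → ℂ} (hg : Continuous g) (hh : Continuous h)
    (hgh : ∀ s t, g s ≠ h t) :
    ∃ A B C D : ℝ → ℂ, (Continuous A ∧ ∀ t, Complex.exp (A t) = g t - h 0) ∧
      (Continuous B ∧ ∀ t, Complex.exp (B t) = g t - h 1) ∧
      (Continuous C ∧ ∀ t, Complex.exp (C t) = h t - g 0) ∧
      (Continuous D ∧ ∀ t, Complex.exp (D t) = h t - g 1) ∧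
      (B 1 - B 0) - (A 1 - A 0) - (D 1 - D 0) + (C 1 - C 0) = 0 := by
  obtain ⟨L, hL, hLe⟩ := exists_continuous_log (f := fun x => g x.1 - h x.2) (by fun_prop)
    fun x => sub_ne_zero.2 (hgh _ _)
  refine ⟨fun s => L (s, 0), fun s => L (s, 1), fun t => L (0, t) + Real.pi * Complex.I,
    fun t => L (1, t) + Real.pi * Complex.I, ⟨by fun_prop, fun t => hLe _⟩,
    ⟨by fun_prop, fun t => hLe _⟩, ⟨by fun_prop, fun t => ?_⟩, ⟨by fun_prop, fun t => ?_⟩, by ring⟩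
  all_goals
    rw [Complex.exp_add, hLe, Complex.exp_pi_mul_I]
    ring

/-- Non-planarity of `K₅` for paths in `ℂ` parametrized by the whole line. -/
theorem not_pairwise_disjoint_paths (z : Fin 5 → ℂ) (hz : Function.Injective z)
    (g : Fin 5 → Fin 5 → ℝ → ℂ) (hg : ∀ i j, i < j → Continuous (g i j))
    (h0 : ∀ i j, i < j → g i j 0 = z i) (h1 : ∀ i j, i < j → g i j 1 = z j) :
    ¬ ∀ i j k l : Fin 5, i < j → k < l → i ≠ k → i ≠ l → j ≠ k → j ≠ l →
      ∀ s t, g i j s ≠ g k l t := by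
  intro H
  obtain ⟨a, ha, hswap⟩ := exists_log_differences z hz
  have hn : ∀ i j k : Fin 5, ∃ n : ℤ, i < j → i ≠ k → j ≠ k →
      ∀ G : ℝ → ℂ, Continuous G → (∀ t, Complex.exp (G t) = g i j t - z k) →
        G 1 - G 0 = a j k - a i k + n * (2 * Real.pi * Complex.I) := by
    intro i j k
    by_cases h : i < j ∧ i ≠ k ∧ j ≠ k
    · obtain ⟨hij, hik, hjk⟩ := h
      obtain ⟨n, hn⟩ := exists_winding_int (g i j) (z k) (a i k) (a j k)
        (by rw [ha i k hik, h0 i j hij]) (by rw [ha j k hjk, h1 i j hij])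
      exact ⟨n, fun _ _ _ => hn⟩
    · exact ⟨0, fun h₁ h₂ h₃ => absurd ⟨h₁, h₂, h₃⟩ h⟩
  choose n hn using hn
  let e : Fin 5 → Fin 5 → ℤ := fun i j => if i < j then -1 else 1
  have he : ∀ i j, i ≠ j → a i j - a j i = e i j * (Real.pi * Complex.I) := by
    intro i j hij
    rcases lt_or_gt_of_ne hij with h | h
    · simp [e, h, hswap i j h]
    · simp [e, h.not_gt, hswap j i h]
  have hrel : ∀ i j k l : Fin 5, i < j → k < l → i ≠ k → i ≠ l → j ≠ k → j ≠ l →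
      2 * (n i j l - n i j k - n k l j + n k l i) + (e j l - e i l - e j k + e i k) = 0 := by
    intro i j k l hij hkl hik hil hjk hjl
    obtain ⟨A, B, C, D, ⟨hA, hAe⟩, ⟨hB, hBe⟩, ⟨hC, hCe⟩, ⟨hD, hDe⟩, hsum⟩ :=
      exists_log_increments (hg i j hij) (hg k l hkl) (H i j k l hij hkl hik hil hjk hjl)
    rw [h0 k l hkl] at hAe
    rw [h1 k l hkl] at hBe
    rw [h0 i j hij] at hCe
    rw [h1 i j hij] at hDe
    have eA := hn i j k hij hik hjk A hA hAe
    have eB := hn i j l hij hil hjl B hB hBe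
    have eC := hn k l i hkl hik.symm hil.symm C hC hCe
    have eD := hn k l j hkl hjk.symm hjl.symm D hD hDe
    have hpi : (Real.pi * Complex.I : ℂ) ≠ 0 := by simp [Real.pi_ne_zero]
    have hc : ((2 * (n i j l - n i j k - n k l j + n k l i)
        + (e j l - e i l - e j k + e i k) : ℤ) : ℂ) * (Real.pi * Complex.I) = 0 := by
      push_cast
      linear_combination hsum - eB + eA + eD - eC - he j l hjl + he i l hil + he j k hjk
        - he i k hik
    exact_mod_cast (mul_eq_zero.1 hc).resolve_right hpi
  have r1 := hrel 0 1 2 3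
  have r2 := hrel 0 2 1 3
  have r3 := hrel 0 3 1 2
  have r4 := hrel 0 1 2 4
  have r5 := hrel 0 2 1 4
  have r6 := hrel 0 4 1 2
  have r7 := hrel 0 1 3 4
  have r8 := hrel 0 3 1 4
  have r9 := hrel 0 4 1 3
  have r10 := hrel 0 2 3 4
  have r11 := hrel 0 3 2 4
  have r12 := hrel 0 4 2 3
  have r13 := hrel 1 2 3 4
  have r14 := hrel 1 3 2 4
  have r15 := hrel 1 4 2 3
  simp [e] at r1 r2 r3 r4 r5 r6 r7 r8 r9 r10 r11 r12 r13 r14 r15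
  omega

/-- Non-planarity of `K₅` with paths: given five distinct points in the plane and a path
joining each pair, two paths joining four distinct points must intersect. -/
theorem stmt_13 (p : Fin 5 → ℝ × ℝ) (hp : Function.Injective p)
    (γ : Fin 5 → Fin 5 → ℝ → ℝ × ℝ)
    (hcont : ∀ i j : Fin 5, i < j → ContinuousOn (γ i j) (Icc 0 1))
    (h0 : ∀ i j : Fin 5, i < j → γ i j 0 = p i)
    (h1 : ∀ i j : Fin 5, i < j → γ i j 1 = p j) :
    ∃ i j k l : Fin 5, i < j ∧ k < l ∧ i ≠ k ∧ i ≠ l ∧ j ≠ k ∧ j ≠ l ∧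
      (γ i j '' Icc 0 1 ∩ γ k l '' Icc 0 1).Nonempty := by
  by_contra hcon
  let φ := Complex.equivRealProdCLM.symm
  refine not_pairwise_disjoint_paths (fun i => φ (p i)) (φ.injective.comp hp)
    (fun i j t => φ (γ i j (projIcc (0 : ℝ) 1 zero_le_one t))) (fun i j hij => ?_)
    (fun i j hij => ?_) (fun i j hij => ?_) ?_
  · exact φ.continuous.comp ((hcont i j hij).comp_continuous
      (continuous_subtype_val.comp continuous_projIcc) fun t => Subtype.property _)
  · simp [h0 i j hij]
  · simp [h1 i j hij]
  · intro i j k l hij hkl hik hil hjk hjl s t hst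
    exact hcon ⟨i, j, k, l, hij, hkl, hik, hil, hjk, hjl, _,
      mem_image_of_mem _ (projIcc (0 : ℝ) 1 zero_le_one s).2,
      _, (projIcc (0 : ℝ) 1 zero_le_one t).2, (φ.injective hst).symm⟩
end

section
/- Let S be a strong Pouna set and let T be a positive transformation of ℝ². Then Ter(T(S)) = T(Ter(S)); in particular, T(S) is a strong Pouna set. -/
open Set

/-- A positive transformation of the plane. -/
def PosTransform (T : ℝ × ℝ → ℝ × ℝ) : Prop :=
  ∃ a b c d : ℝ, 0 < a ∧ 0 < b ∧ ∀ p : ℝ × ℝ, T p = (a * p.1 + c, b * p.2 + d)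

/-- A product of order isomorphisms commutes with taking the bounding box. -/
theorem boxS_image_prodMap (f g : ℝ ≃o ℝ) {S : Set (ℝ × ℝ)} (hne : S.Nonempty)
    (hc : IsCompact S) : boxS (Prod.map f g '' S) = Prod.map f g '' boxS S := by
  have hfst : Prod.fst '' (Prod.map f g '' S) = f '' (Prod.fst '' S) := by
    simp only [image_image, Prod.map_fst]
  have hsnd : Prod.snd '' (Prod.map f g '' S) = g '' (Prod.snd '' S) := by
    simp only [image_image, Prod.map_snd]
  have hcfst := hc.image continuous_fst
  have hcsnd := hc.image continuous_snd
  simp only [boxS, lS, rS, bS, tS, prodMap_image_prod, OrderIso.image_Icc, hfst, hsnd,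
    f.map_csInf' (hne.image _) hcfst.bddBelow, f.map_csSup' (hne.image _) hcfst.bddAbove,
    g.map_csInf' (hne.image _) hcsnd.bddBelow, g.map_csSup' (hne.image _) hcsnd.bddAbove]

/-- A product of order isomorphisms commutes with taking the territory. -/
theorem Ter_image_prodMap (f g : ℝ ≃o ℝ) {S : Set (ℝ × ℝ)} (hne : S.Nonempty)
    (hc : IsCompact S) : Ter (Prod.map f g '' S) = Prod.map f g '' Ter S := by
  have hinj : Function.Injective (Prod.map f g) := f.injective.prodMap g.injective
  have hmem : ∀ (A : Set (ℝ × ℝ)) (x y : ℝ), (f x, g y) ∈ Prod.map f g '' A ↔ (x, y) ∈ A :=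
    fun A x y => hinj.mem_set_image (a := (x, y))
  ext ⟨u, v⟩
  obtain ⟨x, rfl⟩ := f.surjective u
  obtain ⟨y, rfl⟩ := g.surjective v
  rw [hmem]
  simp only [Ter, boxS_image_prodMap f g hne hc, mem_ofPred_eq, mem_sdiff, hmem]
  rw [f.surjective.exists]
  simp only [hmem, gt_iff_lt, f.lt_iff_lt]

/-- A product of order isomorphisms preserves Pouna sets. -/
theorem Pouna.image_prodMap (f g : ℝ ≃o ℝ) {S : Set (ℝ × ℝ)} (hS : Pouna S) :
    Pouna (Prod.map f g '' S) := by
  obtain ⟨hne, hc, hp, hrect⟩ := hS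
  have hcont : Continuous (Prod.map f g) := f.continuous.prodMap g.continuous
  refine ⟨hne.image _, hc.image hcont, hp.image hcont, ?_⟩
  rintro ⟨a, b, c, d, h⟩
  refine hrect ⟨f.symm a, f.symm b, g.symm c, g.symm d,
    (f.injective.prodMap g.injective).image_injective ?_⟩
  simp only [h, prodMap_image_prod, OrderIso.image_Icc, OrderIso.apply_symm_apply]

/-- A positive transformation is a product of order isomorphisms of the line. -/
theorem PosTransform.exists_eq_prodMap {T : ℝ × ℝ → ℝ × ℝ} (hT : PosTransform T) :
    ∃ f g : ℝ ≃o ℝ, T = Prod.map f g := by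
  obtain ⟨a, b, c, d, ha, hb, h⟩ := hT
  exact ⟨(OrderIso.mulLeft₀ a ha).trans (OrderIso.addRight c),
    (OrderIso.mulLeft₀ b hb).trans (OrderIso.addRight d), funext h⟩

/-- Territories behave well under positive transformations: `Ter(T(S)) = T(Ter(S))`,
and in particular `T(S)` is a strong Pouna set. -/
theorem stmt_14 (S : Set (ℝ × ℝ)) (T : ℝ × ℝ → ℝ × ℝ)
    (hS : Strong S) (hT : PosTransform T) :
    Ter (T '' S) = T '' Ter S ∧ Strong (T '' S) := by
  obtain ⟨f, g, rfl⟩ := hT.exists_eq_prodMap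
  obtain ⟨hP, hne⟩ := hS
  have hTer := Ter_image_prodMap f g hP.1 hP.2.1
  exact ⟨hTer, hP.image_prodMap f g, hTer ▸ hne.image _⟩
end

section
/- Let F be a finite family of Pouna sets and let P be a stable prob for F. Then for every root R of P and every A ∈ N(P), we have R ⊆ Ter(A). -/
open Set

/-- `A` crosses the rectangle `[x₁,x₂] × [y₁,y₂]` vertically. -/
def CrossesVert (A : Set (ℝ × ℝ)) (x₁ x₂ y₁ y₂ : ℝ) : Prop :=
  ∃ γ : ℝ → ℝ × ℝ, ContinuousOn γ (Icc 0 1) ∧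
    MapsTo γ (Icc (0:ℝ) 1) (A ∩ (Icc x₁ x₂ ×ˢ Icc y₁ y₂)) ∧
    (γ 0).2 = y₁ ∧ (γ 1).2 = y₂

/-- The bounding box of a family of sets. -/
noncomputable def famBox (F : Set (Set (ℝ × ℝ))) : Set (ℝ × ℝ) := boxS (⋃₀ F)

/-- A prob for the family `F`. -/
def IsProb (F : Set (Set (ℝ × ℝ))) (P : Set (ℝ × ℝ)) : Prop :=
  (∃ x₁ x₂ y₁ y₂ : ℝ, x₁ ≤ x₂ ∧ y₁ ≤ y₂ ∧ P = Icc x₁ x₂ ×ˢ Icc y₁ y₂) ∧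
  P ⊆ famBox F ∧ rS P = rS (famBox F)

/-- The elements of `F` meeting the prob `P`. -/
def NP (F : Set (Set (ℝ × ℝ))) (P : Set (ℝ × ℝ)) : Set (Set (ℝ × ℝ)) :=
  {A ∈ F | (A ∩ P).Nonempty}

/-- A root of the prob `P` for the family `F`. -/
def IsRoot (F : Set (Set (ℝ × ℝ))) (P R : Set (ℝ × ℝ)) : Prop :=
  (∃ x₀ : ℝ, lS P < x₀ ∧ x₀ < rS P ∧ R = {p ∈ P | p.1 ≤ x₀}) ∧
  ∀ A ∈ F, A ∩ R = ∅

/-- A stable prob for the family `F`. -/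
def StableProb (F : Set (Set (ℝ × ℝ))) (P : Set (ℝ × ℝ)) : Prop :=
  IsProb F P ∧
  (∃ R, IsRoot F P R ∧ ∀ A ∈ NP F P, R ⊆ Ter A) ∧
  (∀ A ∈ NP F P, ∀ B ∈ NP F P, A ≠ B → A ∩ B = ∅) ∧
  (∀ A ∈ NP F P, bS A < bS P ∧ tS P < tS A) ∧
  (∀ A ∈ NP F P, CrossesVert A (lS P) (rS P) (bS P) (tS P))

/-- A rectangle crossed vertically by `A` contains a point of `A` at each of its heights. -/
theorem CrossesVert.exists_mem {A : Set (ℝ × ℝ)} {x₁ x₂ y₁ y₂ y : ℝ}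
    (h : CrossesVert A x₁ x₂ y₁ y₂) (hy : y ∈ Icc y₁ y₂) :
    ∃ x ∈ Icc x₁ x₂, (x, y) ∈ A := by
  obtain ⟨γ, hγ, hmaps, h0, h1⟩ := h
  have hsnd : ContinuousOn (fun t => (γ t).2) (Icc 0 1) := continuous_snd.comp_continuousOn hγ
  obtain ⟨t, ht, rfl⟩ := intermediate_value_Icc zero_le_one hsnd (by simpa only [h0, h1] using hy)
  exact ⟨(γ t).1, (hmaps ht).2.1, (hmaps ht).1⟩

/-- For a stable prob `P` of a finite family of Pouna sets, every root of `P` is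
contained in the territory of every element of `N(P)`. -/
theorem stmt_18 (F : Set (Set (ℝ × ℝ))) (P : Set (ℝ × ℝ))
    (hfin : F.Finite) (hpouna : ∀ S ∈ F, Pouna S)
    (hstable : StableProb F P) :
    ∀ R : Set (ℝ × ℝ), IsRoot F P R → ∀ A ∈ NP F P, R ⊆ Ter A := by
  rintro R ⟨⟨c, hc, hc', rfl⟩, hR⟩ A hA p ⟨hp, hpc⟩
  obtain ⟨⟨⟨x₁, x₂, y₁, y₂, hx, hy, rfl⟩, -⟩, ⟨_, ⟨⟨c₀, hc₀, -, rfl⟩, -⟩, hTer⟩, -, hbt, hcross⟩ :=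
    hstable
  have hne_x : (Icc x₁ x₂).Nonempty := nonempty_Icc.2 hx
  have hne_y : (Icc y₁ y₂).Nonempty := nonempty_Icc.2 hy
  have hl : lS (Icc x₁ x₂ ×ˢ Icc y₁ y₂) = x₁ := by
    rw [lS, fst_image_prod _ hne_y, csInf_Icc hx]
  have hr : rS (Icc x₁ x₂ ×ˢ Icc y₁ y₂) = x₂ := by
    rw [rS, fst_image_prod _ hne_y, csSup_Icc hx]
  have hb : bS (Icc x₁ x₂ ×ˢ Icc y₁ y₂) = y₁ := by
    rw [bS, snd_image_prod hne_x, csInf_Icc hy]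
  have ht : tS (Icc x₁ x₂ ×ˢ Icc y₁ y₂) = y₂ := by
    rw [tS, snd_image_prod hne_x, csSup_Icc hy]
  have hbtA := hbt A hA
  have hcrossA := hcross A hA
  rw [hl, hr, hb, ht] at hcrossA
  rw [hb, ht] at hbtA
  rw [hl] at hc₀
  have hnot : ∀ q ∈ A, q ∈ Icc x₁ x₂ ×ˢ Icc y₁ y₂ → c < q.1 := fun q hqA hqP =>
    not_le.1 fun hqc => (hR A hA.1).subset ⟨hqA, hqP, hqc⟩
  obtain ⟨x', hx', hxA⟩ := hcrossA.exists_mem hp.2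
  have hlt : p.1 < x' := lt_of_le_of_lt hpc (hnot _ hxA ⟨hx', hp.2⟩)
  have hlA : lS A ≤ x₁ :=
    (hTer A hA (show (x₁, y₁) ∈ _ from
      ⟨⟨left_mem_Icc.2 hx, left_mem_Icc.2 hy⟩, hc₀.le⟩)).1.1.1.1
  have hrA : x' ≤ rS A :=
    le_csSup ((hpouna A hA.1).2.1.image continuous_fst).bddAbove ⟨_, hxA, rfl⟩
  exact ⟨⟨⟨⟨hlA.trans hp.1.1, hlt.le.trans hrA⟩,
    ⟨hbtA.1.le.trans hp.2.1, hp.2.2.trans hbtA.2.le⟩⟩,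
    fun hpA => (hnot p hpA hp).not_ge hpc⟩, x', hlt, hxA⟩
end
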